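/- For each vertex i ∈ V, the probability P_{s_0}{ i_τ = i } that the epicenter equals i converges to α_i as |s_0| → −∞. -/

import Mathlib

open scoped BigOperators
open Classical Filter

noncomputable section

namespace ThresholdState

variable {V : Type*} [Fintype V] [DecidableEq V]

/-- `A i j` is the number of directed edges from `i` to `j`. -/
def outdeg (A : V → V → ℕ) (i : V) : ℕ := ∑ j, A i j

def indeg (A : V → V → ℕ) (i : V) : ℕ := ∑ j, A j i

/-- Eulerian: out-degree equals in-degree at every vertex. -/
def Eulerian (A : V → V → ℕ) : Prop := ∀ i, outdeg A i = indeg A i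

/-- (Strongly) connected multigraph. -/
def Connected (A : V → V → ℕ) : Prop :=
  ∀ i j : V, Relation.ReflTransGen (fun a b => 0 < A a b) i j

def deg (A : V → V → ℕ) (i : V) : ℕ := outdeg A i

/-- Graph Laplacian: `Δu(i) = -deg(i)·u(i) + Σ_{e incoming to i} u(e⁻)`. -/
def lap (A : V → V → ℕ) (u : V → ℤ) (i : V) : ℤ :=
  -(deg A i : ℤ) * u i + ∑ j, (A j i : ℤ) * u j

def delta (z : V) : V → ℤ := fun j => if j = z then 1 else 0

/-- Toppling vertex `i`: replace `s` by `s + Δδ_i`. -/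
def toppleAt (A : V → V → ℕ) (s : V → ℤ) (i : V) : V → ℤ :=
  fun j => s j + lap A (delta i) j

def applySeq (A : V → V → ℕ) (s : V → ℤ) (l : List V) : V → ℤ :=
  l.foldl (toppleAt A) s

/-- A legal toppling sequence (avoiding the forbidden set `F`): each toppled
vertex is unstable when toppled and does not lie in `F`. -/
def ValidSeq (A : V → V → ℕ) (F : V → Prop) : (V → ℤ) → List V → Prop
  | _, [] => True
  | s, i :: l => ¬ F i ∧ (deg A i : ℤ) ≤ s i ∧ ValidSeq A F (toppleAt A s i) l

/-- Stable at every non-forbidden vertex. -/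
def StableOff (A : V → V → ℕ) (F : V → Prop) (s : V → ℤ) : Prop :=
  ∀ i, ¬ F i → s i ≤ (deg A i : ℤ) - 1

def StabilizesTo (A : V → V → ℕ) (F : V → Prop) (s : V → ℤ) (l : List V) : Prop :=
  ValidSeq A F s l ∧ StableOff A F (applySeq A s l)

def StabilizableVia (A : V → V → ℕ) (F : V → Prop) (s : V → ℤ) : Prop :=
  ∃ l, StabilizesTo A F s l

/-- Stabilizable with no forbidden vertices. -/
def Stabilizable (A : V → V → ℕ) (s : V → ℤ) : Prop :=
  StabilizableVia A (fun _ => False) s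

def stabSeq (A : V → V → ℕ) (F : V → Prop) (s : V → ℤ) : List V :=
  if h : StabilizableVia A F s then h.choose else []

def stabilizeVia (A : V → V → ℕ) (F : V → Prop) (s : V → ℤ) : V → ℤ :=
  applySeq A s (stabSeq A F s)

/-- Odometer: number of topplings at each vertex (`0` everywhere if not stabilizable). -/
def odometerVia (A : V → V → ℕ) (F : V → Prop) (s : V → ℤ) : V → ℕ :=
  fun i => (stabSeq A F s).count i

def sinkStabilize (A : V → V → ℕ) (z : V) (s : V → ℤ) : V → ℤ :=
  stabilizeVia A (fun i => i = z) s

def sinkOdometer (A : V → V → ℕ) (z : V) (s : V → ℤ) : V → ℕ :=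
  odometerVia A (fun i => i = z) s

/-- `ρ` is `z`-recurrent (Dhar's burning test): `ρ(z) = deg z`, `ρ(i) ≤ deg i - 1`
off the sink, and every site other than `z` topples exactly once in the
stabilization of `ρ + Δδ_z` with sink `z`. -/
def ZRec (A : V → V → ℕ) (z : V) (ρ : V → ℤ) : Prop :=
  ρ z = (deg A z : ℤ) ∧ (∀ i, i ≠ z → ρ i ≤ (deg A i : ℤ) - 1) ∧
  ∃ l : List V, StabilizesTo A (fun i => i = z) (fun j => ρ j + lap A (delta z) j) l ∧
    ∀ i, i ≠ z → l.count i = 1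

/-- `κ` = number of `z`-recurrent sandpiles. -/
def kappa (A : V → V → ℕ) (z : V) : ℕ := Nat.card {ρ : V → ℤ // ZRec A z ρ}

def totalMass (s : V → ℤ) : ℤ := ∑ i, s i

/-- Open addition operator `â_i` (with sink `z`). -/
def openAdd (A : V → V → ℕ) (z i : V) (ρ : V → ℤ) : V → ℤ :=
  fun j => if j = z then (deg A z : ℤ) else sinkStabilize A z (fun k => ρ k + delta i k) j

/-- `â_i⁻¹` on `Rec(z)`. -/
def openAddInv (A : V → V → ℕ) (z i : V) (ρ : V → ℤ) : V → ℤ :=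
  if h : ∃ ρ', ZRec A z ρ' ∧ openAdd A z i ρ' = ρ then h.choose else ρ

/-- Burst size `av_{i→z}(ρ) = |â_i⁻¹ρ| - |ρ| + 1`. -/
def burst (A : V → V → ℕ) (z i : V) (ρ : V → ℤ) : ℤ :=
  totalMass (openAddInv A z i ρ) - totalMass ρ + 1

/-- The `z`-recurrent decomposition `s = ρ + m·δ_z + Δv` with `ρ ∈ Rec(z)`, `v(z)=0`. -/
def ZDecomp (A : V → V → ℕ) (z : V) (s ρ : V → ℤ) (m : ℤ) (v : V → ℤ) : Prop :=
  ZRec A z ρ ∧ v z = 0 ∧ ∀ j, s j = ρ j + m * delta z j + lap A v j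

/-- `R_z(s)`: the `z`-recurrent representative of `s`. -/
def Rz (A : V → V → ℕ) (z : V) (s : V → ℤ) : V → ℤ :=
  if h : ∃ ρ, ∃ m, ∃ v, ZDecomp A z s ρ m v then h.choose else s

/-- `m_z(s)`: the integer in the `z`-recurrent decomposition of `s`. -/
def mz (A : V → V → ℕ) (z : V) (s : V → ℤ) : ℤ :=
  if h : ∃ m, ∃ ρ, ∃ v, ZDecomp A z s ρ m v then h.choose else 0

/-- Closed addition operator `a_i`. -/
def closedAdd (A : V → V → ℕ) (i : V) (s : V → ℤ) : V → ℤ :=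
  if Stabilizable A (fun j => s j + delta i j) then
    stabilizeVia A (fun _ => False) (fun j => s j + delta i j)
  else fun j => s j + delta i j

/-- The closed chain after making the additions listed in `w` (in order). -/
def chain (A : V → V → ℕ) (s0 : V → ℤ) (w : List V) : V → ℤ :=
  w.foldl (fun s i => closedAdd A i s) s0

/-- `w` is a threshold word for `s0`: the chain first becomes non-stabilizable
exactly after the additions in `w`, i.e. `τ = |w|` on the cylinder of `w`. -/
def IsThresholdWord (A : V → V → ℕ) (s0 : V → ℤ) (w : List V) : Prop :=
  ¬ Stabilizable A (chain A s0 w) ∧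
  ∀ w' : List V, w' <+: w → w' ≠ w → Stabilizable A (chain A s0 w')

def wordProb (α : V → ℝ) (w : List V) : ℝ := (w.map α).prod

/-- `P_{s0}(E at the threshold time)`: total probability of the (disjoint)
cylinders of threshold words satisfying `E`. -/
def thresholdProb (A : V → V → ℕ) (α : V → ℝ) (s0 : V → ℤ) (E : List V → Prop) : ℝ :=
  ∑' w : List V, if IsThresholdWord A s0 w ∧ E w then wordProb α w else 0

/-- `E_{s0}[f at the threshold time]`. -/
def thresholdExp (A : V → V → ℕ) (α : V → ℝ) (s0 : V → ℤ) (f : List V → ℝ) : ℝ :=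
  ∑' w : List V, if IsThresholdWord A s0 w then wordProb α w * f w else 0

end ThresholdState

section StepOperator

variable {V Q : Type*} [Fintype V] [AddCommGroup Q]

/-- The transition operator of the random walk on `Q` taking the step `g v` with probability
`α v`. -/
def stepOp (α : V → ℝ) (g : V → Q) : Module.End ℝ (Q → ℝ) where
  toFun φ y := ∑ v, α v * φ (y + g v)
  map_add' φ ψ := by
    ext y
    simp [mul_add, Finset.sum_add_distrib]
  map_smul' c φ := by
    ext y
    simp [Finset.mul_sum, mul_left_comm]

variable {α : V → ℝ} {g : V → Q}

lemma stepOp_apply (φ : Q → ℝ) (y : Q) : stepOp α g φ y = ∑ v, α v * φ (y + g v) := rfl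

lemma stepOp_pow_mono (hα : ∀ v, 0 < α v) (k : ℕ) {φ ψ : Q → ℝ} (h : φ ≤ ψ) :
    (stepOp α g ^ k) φ ≤ (stepOp α g ^ k) ψ := by
  induction k with
  | zero => simpa using h
  | succ k ih =>
    rw [pow_succ', Module.End.mul_apply, Module.End.mul_apply]
    exact fun y => Finset.sum_le_sum fun v _ => mul_le_mul_of_nonneg_left (ih _) (hα v).le

lemma stepOp_pow_const (hsum : ∑ v, α v = 1) (k : ℕ) (c : ℝ) :
    (stepOp α g ^ k) (fun _ => c) = fun _ => c := by
  induction k with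
  | zero => simp
  | succ k ih =>
    rw [pow_succ', Module.End.mul_apply, ih]
    ext y
    rw [stepOp_apply, ← Finset.sum_mul, hsum, one_mul]

lemma norm_stepOp_le [Fintype Q] (hα : ∀ v, 0 < α v) (hsum : ∑ v, α v = 1) (φ : Q → ℝ) :
    ‖stepOp α g φ‖ ≤ ‖φ‖ := by
  refine (pi_norm_le_iff_of_nonneg (norm_nonneg _)).2 fun y => ?_
  calc ‖stepOp α g φ y‖ ≤ ∑ v, ‖α v * φ (y + g v)‖ := norm_sum_le _ _
    _ ≤ ∑ v, α v * ‖φ‖ := Finset.sum_le_sum fun v _ => by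
        rw [norm_mul, Real.norm_of_nonneg (hα v).le]
        exact mul_le_mul_of_nonneg_left (norm_le_pi_norm φ _) (hα v).le
    _ = ‖φ‖ := by rw [← Finset.sum_mul, hsum, one_mul]

lemma sum_stepOp [Fintype Q] (hsum : ∑ v, α v = 1) (φ : Q → ℝ) :
    ∑ y, stepOp α g φ y = ∑ y, φ y := by
  simp only [stepOp_apply]
  rw [Finset.sum_comm]
  have h (v : V) : ∑ y, α v * φ (y + g v) = α v * ∑ y, φ y := by
    rw [← Finset.mul_sum, ← Equiv.sum_comp (Equiv.addRight (g v)) φ]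
    rfl
  simp only [h]
  rw [← Finset.sum_mul, hsum, one_mul]

lemma sum_stepOp_pow [Fintype Q] (hsum : ∑ v, α v = 1) (k : ℕ) (φ : Q → ℝ) :
    ∑ y, (stepOp α g ^ k) φ y = ∑ y, φ y := by
  induction k with
  | zero => simp
  | succ k ih => rw [pow_succ', Module.End.mul_apply, sum_stepOp hsum, ih]

lemma stepOp_pow_single_nonneg (hα : ∀ v, 0 < α v) (k : ℕ) (x y : Q) :
    0 ≤ (stepOp α g ^ k) (Pi.single x 1) y := by
  have h := stepOp_pow_mono (g := g) hα k (φ := 0) (ψ := Pi.single x (1 : ℝ))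
    (Pi.single_nonneg.2 zero_le_one) y
  simpa using h

lemma stepOp_pow_succ_single_pos (hα : ∀ v, 0 < α v) {k : ℕ} {x y : Q} (v : V)
    (h : 0 < (stepOp α g ^ k) (Pi.single x 1) (y + g v)) :
    0 < (stepOp α g ^ (k + 1)) (Pi.single x 1) y := by
  rw [pow_succ', Module.End.mul_apply, stepOp_apply]
  exact Finset.sum_pos' (fun u _ => mul_nonneg (hα u).le (stepOp_pow_single_nonneg hα _ _ _))
    ⟨v, Finset.mem_univ _, mul_pos (hα v) h⟩

lemma exists_stepOp_pow_single_pos (hα : ∀ v, 0 < α v)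
    (hgen : AddSubmonoid.closure (Set.range g) = ⊤) (x y : Q) :
    ∃ k, 0 < (stepOp α g ^ k) (Pi.single x 1) y := by
  have key : ∀ d ∈ AddSubmonoid.closure (Set.range g), ∀ y,
      (∃ k, 0 < (stepOp α g ^ k) (Pi.single x 1) (y + d)) →
      ∃ k, 0 < (stepOp α g ^ k) (Pi.single x 1) y := by
    intro d hd
    induction hd using AddSubmonoid.closure_induction with
    | mem d hd =>
      obtain ⟨v, rfl⟩ := hd
      rintro y ⟨k, hk⟩
      exact ⟨k + 1, stepOp_pow_succ_single_pos hα v hk⟩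
    | zero => simp
    | add a b _ _ ha hb =>
      intro y h
      rw [← add_assoc] at h
      exact ha y (hb _ h)
  refine key (x - y) (hgen ▸ AddSubmonoid.mem_top _) y ⟨0, ?_⟩
  simp

lemma exists_forall_stepOp_pow_single_pos [Fintype Q] (hα : ∀ v, 0 < α v)
    (hgen : AddSubmonoid.closure (Set.range g) = ⊤) {z : V} (hz : g z = 0) :
    ∃ m, ∀ x y : Q, 0 < (stepOp α g ^ m) (Pi.single x 1) y := by
  choose k hk using exists_stepOp_pow_single_pos (g := g) hα hgen
  have mono (x y : Q) (m : ℕ) (hm : k x y ≤ m) : 0 < (stepOp α g ^ m) (Pi.single x 1) y := by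
    induction m, hm using Nat.le_induction with
    | base => exact hk x y
    | succ n _ ih => exact stepOp_pow_succ_single_pos hα z (by rwa [hz, add_zero])
  refine ⟨∑ x, ∑ y, k x y, fun x y => mono x y _ ?_⟩
  exact (Finset.single_le_sum (f := fun y => k x y) (fun _ _ => Nat.zero_le _)
    (Finset.mem_univ y)).trans
    (Finset.single_le_sum (f := fun x => ∑ y, k x y) (fun _ _ => Nat.zero_le _)
      (Finset.mem_univ x))

/-- Doeblin's minorization for an irreducible walk with a holding step. -/
lemma exists_stepOp_pow_minorization [Fintype Q] (hα : ∀ v, 0 < α v)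
    (hgen : AddSubmonoid.closure (Set.range g) = ⊤) {z : V} (hz : g z = 0) :
    ∃ m : ℕ, ∃ β : ℝ, 0 < β ∧
      ∀ φ : Q → ℝ, 0 ≤ φ → ∀ y, β * ∑ x, φ x ≤ (stepOp α g ^ m) φ y := by
  obtain ⟨m, hm⟩ := exists_forall_stepOp_pow_single_pos (Q := Q) hα hgen hz
  obtain ⟨p, hp⟩ := Finite.exists_min
    (fun p : Q × Q => (stepOp α g ^ m) (Pi.single p.1 1) p.2)
  refine ⟨m, _, hm p.1 p.2, fun φ hφ y => ?_⟩
  rw [LinearMap.pi_apply_eq_sum_univ (stepOp α g ^ m) φ, Finset.sum_apply, Finset.mul_sum]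
  refine Finset.sum_le_sum fun x _ => ?_
  rw [Pi.smul_apply, smul_eq_mul, mul_comm]
  refine mul_le_mul_of_nonneg_left ?_ (hφ x)
  convert hp (x, y) using 2
  ext t
  simp [Pi.single_apply, eq_comm]

lemma tendsto_norm_stepOp_pow_of_sum_eq_zero [Fintype Q] (hα : ∀ v, 0 < α v)
    (hsum : ∑ v, α v = 1)
    (hgen : AddSubmonoid.closure (Set.range g) = ⊤) {z : V} (hz : g z = 0)
    {φ : Q → ℝ} (hφ : ∑ y, φ y = 0) :
    Tendsto (fun k => ‖(stepOp α g ^ k) φ‖) atTop (nhds 0) := by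
  obtain ⟨m, β, hβ, hmin⟩ := exists_stepOp_pow_minorization (Q := Q) hα hgen hz
  have hcard : (0 : ℝ) < Fintype.card Q := by exact_mod_cast Fintype.card_pos
  have lower (ψ : Q → ℝ) (hψ : ∑ y, ψ y = 0) (y : Q) :
      -((1 - β * Fintype.card Q) * ‖ψ‖) ≤ (stepOp α g ^ m) ψ y := by
    have h := hmin (ψ + fun _ => ‖ψ‖)
      (fun y => by
        have := (abs_le.1 (Real.norm_eq_abs _ ▸ norm_le_pi_norm ψ y)).1
        simp only [Pi.zero_apply, Pi.add_apply]
        linarith) y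
    rw [map_add, stepOp_pow_const hsum] at h
    simp only [Pi.add_apply, Finset.sum_add_distrib, hψ, Finset.sum_const, Finset.card_univ,
      nsmul_eq_mul] at h
    linarith
  have contract (ψ : Q → ℝ) (hψ : ∑ y, ψ y = 0) :
      ‖(stepOp α g ^ m) ψ‖ ≤ (1 - β * Fintype.card Q) * ‖ψ‖ := by
    refine (pi_norm_le_iff_of_nonempty _).2 fun y => ?_
    rw [Real.norm_eq_abs, abs_le]
    refine ⟨lower ψ hψ y, ?_⟩
    have h := lower (-ψ) (by simp [hψ]) y
    rw [map_neg, norm_neg, Pi.neg_apply] at h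
    linarith
  have anti : Antitone fun k => ‖(stepOp α g ^ k) φ‖ :=
    antitone_nat_of_succ_le fun k => by
      rw [pow_succ', Module.End.mul_apply]
      exact norm_stepOp_le hα hsum _
  have hlim := tendsto_atTop_ciInf anti ⟨0, by rintro _ ⟨k, rfl⟩; exact norm_nonneg _⟩
  set l := ⨅ k, ‖(stepOp α g ^ k) φ‖
  have hl0 : 0 ≤ l := Real.iInf_nonneg fun k => norm_nonneg _
  have hle : l ≤ (1 - β * Fintype.card Q) * l := by
    refine le_of_tendsto_of_tendsto' ((tendsto_add_atTop_iff_nat m).2 hlim)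
      (hlim.const_mul _) fun k => ?_
    rw [add_comm, pow_add, Module.End.mul_apply]
    exact contract _ (by rw [sum_stepOp_pow hsum, hφ])
  have : l = 0 := by
    have := mul_pos hβ hcard
    nlinarith
  rwa [this] at hlim

/-- An irreducible random walk with a holding step on a finite abelian group equidistributes. -/
lemma tendsto_norm_stepOp_pow_sub_average [Fintype Q] (hα : ∀ v, 0 < α v)
    (hsum : ∑ v, α v = 1)
    (hgen : AddSubmonoid.closure (Set.range g) = ⊤) {z : V} (hz : g z = 0) (φ : Q → ℝ) :
    Tendsto (fun k => ‖(stepOp α g ^ k) φ - fun _ => (∑ x, φ x) / Fintype.card Q‖)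
      atTop (nhds 0) := by
  have hcard : (Fintype.card Q : ℝ) ≠ 0 := by exact_mod_cast Fintype.card_ne_zero
  have h := tendsto_norm_stepOp_pow_of_sum_eq_zero (g := g) hα hsum hgen hz
    (φ := φ - fun _ => (∑ x, φ x) / Fintype.card Q) (by simp; field_simp; simp)
  simpa only [map_sub, stepOp_pow_const hsum] using h

/-- The words of length `k` over a finite alphabet. -/
def wordsOfLength (V : Type*) [Fintype V] (k : ℕ) : Finset (List V) :=
  (List.finite_length_eq V k).toFinset

lemma mem_wordsOfLength {k : ℕ} {w : List V} : w ∈ wordsOfLength V k ↔ w.length = k := by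
  simp [wordsOfLength]

lemma sum_wordsOfLength_succ (k : ℕ) (F : List V → ℝ) :
    ∑ w ∈ wordsOfLength V (k + 1), F w = ∑ v, ∑ w ∈ wordsOfLength V k, F (v :: w) := by
  rw [← Finset.sum_product']
  symm
  refine Finset.sum_bij (fun p _ => p.1 :: p.2) ?_ ?_ ?_ fun _ _ => rfl
  · rintro ⟨v, w⟩ h
    simpa [mem_wordsOfLength] using h
  · rintro ⟨v, w⟩ _ ⟨v', w'⟩ _ h
    simpa using h
  · intro w hw
    cases w with
    | nil => simp [mem_wordsOfLength] at hw
    | cons v w => exact ⟨(v, w), by simpa [mem_wordsOfLength] using hw, rfl⟩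

lemma sum_wordProb_mul_eq_stepOp_pow (k : ℕ) (φ : Q → ℝ) (y : Q) :
    ∑ w ∈ wordsOfLength V k, ThresholdState.wordProb α w * φ (y + (w.map g).sum) =
      (stepOp α g ^ k) φ y := by
  induction k generalizing y with
  | zero =>
    have : wordsOfLength V 0 = {[]} := by
      ext w
      simp [mem_wordsOfLength]
    simp [this, ThresholdState.wordProb]
  | succ k ih =>
    rw [sum_wordsOfLength_succ, pow_succ', Module.End.mul_apply, stepOp_apply]
    refine Finset.sum_congr rfl fun v _ => ?_
    rw [← ih, Finset.mul_sum]
    refine Finset.sum_congr rfl fun w _ => ?_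
    simp [ThresholdState.wordProb, mul_assoc, add_assoc]

lemma tsum_wordProb_mul_eq_sum_stepOp_pow {D L : ℕ} {φ : ℕ → Q → ℝ}
    (hφ : ∀ k, (k < D ∨ D + L ≤ k) → φ k = 0) (y : Q) :
    ∑' w : List V, ThresholdState.wordProb α w * φ w.length (y + (w.map g).sum) =
      ∑ j ∈ Finset.range L, (stepOp α g ^ (D + j)) (φ (D + j)) y := by
  rw [tsum_eq_sum (s := (Finset.range L).biUnion fun j => wordsOfLength V (D + j)),
    Finset.sum_biUnion]
  · refine Finset.sum_congr rfl fun j _ => ?_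
    rw [← sum_wordProb_mul_eq_stepOp_pow]
    refine Finset.sum_congr rfl fun w hw => ?_
    rw [mem_wordsOfLength.1 hw]
  · intro j _ j' _ hne
    refine Finset.disjoint_left.2 fun w hw hw' => hne ?_
    have h₁ := mem_wordsOfLength.1 hw
    have h₂ := mem_wordsOfLength.1 hw'
    omega
  · intro w hw
    rw [hφ w.length, Pi.zero_apply, mul_zero]
    by_contra! h
    refine hw (Finset.mem_biUnion.2 ⟨w.length - D, ?_, ?_⟩)
    · rw [Finset.mem_range]
      omega
    · rw [mem_wordsOfLength]
      omega

end StepOperator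

namespace ThresholdState

lemma delta_nonneg {V : Type*} [DecidableEq V] (v : V) : (0 : V → ℤ) ≤ delta v := fun j => by
  rw [delta]
  split_ifs <;> simp

section Laplacian

variable {V : Type*} [Fintype V] {A : V → V → ℕ}

lemma lap_add (u v : V → ℤ) : lap A (u + v) = lap A u + lap A v := by
  ext j
  simp only [lap, Pi.add_apply, mul_add, Finset.sum_add_distrib]
  ring

/-- The Laplacian as a linear map. -/
def lapHom (A : V → V → ℕ) : (V → ℤ) →ₗ[ℤ] (V → ℤ) :=
  (AddMonoidHom.mk' (lap A) lap_add).toIntLinearMap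

lemma lapHom_apply (u : V → ℤ) : lapHom A u = lap A u := rfl

lemma lap_eq_sum_sub (hEul : Eulerian A) (u : V → ℤ) (j : V) :
    lap A u j = ∑ k, (A k j : ℤ) * (u k - u j) := by
  have h : (deg A j : ℤ) = ∑ k, (A k j : ℤ) := by
    rw [deg, hEul j, indeg, Nat.cast_sum]
  rw [lap, h]
  simp only [mul_sub, Finset.sum_sub_distrib, ← Finset.sum_mul]
  ring

lemma lap_const (hEul : Eulerian A) (c : ℤ) : lap A (fun _ => c) = 0 := by
  ext j
  simp [lap_eq_sum_sub hEul]

lemma totalMass_add (s t : V → ℤ) : totalMass (s + t) = totalMass s + totalMass t :=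
  Finset.sum_add_distrib

lemma totalMass_lap (u : V → ℤ) : totalMass (lap A u) = 0 := by
  simp only [totalMass, lap, Finset.sum_add_distrib]
  rw [Finset.sum_comm]
  simp [← Finset.sum_mul, deg, outdeg]

lemma eq_of_lap_eq_zero (hEul : Eulerian A) (hConn : Connected A) {u : V → ℤ}
    (hu : lap A u = 0) (a b : V) : u a = u b := by
  obtain ⟨m, hm⟩ := @Finite.exists_max V ℤ _ ⟨a⟩ _ u
  suffices h : ∀ c, u c = u m by rw [h a, h b]
  intro c
  induction hConn c m using Relation.ReflTransGen.head_induction_on with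
  | refl => rfl
  | @head j k hjk _ ih =>
    have h0 : lap A u k = 0 := by rw [hu]; rfl
    rw [lap_eq_sum_sub hEul] at h0
    have h1 := (Finset.sum_eq_zero_iff_of_nonpos fun l _ =>
      mul_nonpos_of_nonneg_of_nonpos (Nat.cast_nonneg (A l k))
        (sub_nonpos.2 (ih ▸ hm l))).1 h0 j (Finset.mem_univ j)
    have hA : (A j k : ℤ) ≠ 0 := by exact_mod_cast hjk.ne'
    have := (mul_eq_zero.1 h1).resolve_left hA
    omega

variable [DecidableEq V]

lemma totalMass_smul_delta (m : ℤ) (z : V) : totalMass (m • delta z) = m := by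
  simp [totalMass, delta]

lemma totalMass_delta (z : V) : totalMass (delta z) = 1 := by
  simp [totalMass, delta]

/-- Modulo the Laplacian and the sink, sandpiles form a torsion group. -/
lemma exists_smul_eq_lap_add (hEul : Eulerian A) (hConn : Connected A) (z : V) :
    ∃ c : ℤ, 0 < c ∧ ∀ q : V → ℤ, ∃ u : V → ℤ, ∃ m : ℤ, c • q = lap A u + m • delta z := by
  let f : (V → ℤ) →ₗ[ℤ] (V → ℤ) :=
    lapHom A + (LinearMap.proj z).smulRight (delta z)
  have hf (u : V → ℤ) : f u = lap A u + u z • delta z := rfl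
  have hdet : (LinearMap.toMatrix' f).det ≠ 0 := by
    intro h
    obtain ⟨u, hu0, hu⟩ := Matrix.exists_mulVec_eq_zero_iff.2 h
    rw [LinearMap.toMatrix'_mulVec, hf] at hu
    have hz : u z = 0 := by
      have := congrArg totalMass hu
      rw [totalMass_add, totalMass_lap, totalMass_smul_delta] at this
      simpa [totalMass] using this
    rw [hz, zero_smul, add_zero] at hu
    refine hu0 (funext fun a => ?_)
    rw [eq_of_lap_eq_zero hEul hConn hu a z, hz, Pi.zero_apply]
  refine ⟨_, mul_self_pos.2 hdet, fun q => ?_⟩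
  set M := LinearMap.toMatrix' f with hM
  let u := M.adjugate.mulVec (M.det • q)
  refine ⟨u, u z, ?_⟩
  rw [← hf, ← LinearMap.toMatrix'_mulVec f, ← hM, Matrix.mulVec_mulVec, Matrix.mul_adjugate,
    Matrix.smul_mulVec, Matrix.one_mulVec, smul_smul]

end Laplacian

section Stabilizability

variable {V : Type*} [Fintype V] [DecidableEq V] {A : V → V → ℕ}

lemma exists_applySeq_eq (s : V → ℤ) (l : List V) : ∃ u, applySeq A s l = s + lap A u := by
  induction l generalizing s with
  | nil => exact ⟨0, by ext; simp [applySeq, lap]⟩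
  | cons v l ih =>
    obtain ⟨u, hu⟩ := ih (toppleAt A s v)
    refine ⟨delta v + u, ?_⟩
    rw [applySeq, List.foldl_cons, ← applySeq, hu, lap_add, ← add_assoc]
    rfl

lemma stabilizable_of_nonneg {u : V → ℤ} (hu : 0 ≤ u) {s : V → ℤ}
    (hs : ∀ j, s j + lap A u j ≤ (deg A j : ℤ) - 1) : Stabilizable A s := by
  induction hN : (∑ j, u j).toNat using Nat.strong_induction_on generalizing u s with
  | _ N ih =>
  by_cases hst : ∀ j, s j ≤ (deg A j : ℤ) - 1
  · exact ⟨[], trivial, fun j _ => hst j⟩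
  push Not at hst
  obtain ⟨v, hv⟩ := hst
  have huv : 1 ≤ u v := by
    by_contra! h
    have h0 : u v = 0 := le_antisymm (by omega) (hu v)
    have h1 := hs v
    rw [lap, h0, mul_zero, zero_add] at h1
    have : 0 ≤ ∑ j, (A j v : ℤ) * u j :=
      Finset.sum_nonneg fun j _ => mul_nonneg (Nat.cast_nonneg _) (hu j)
    omega
  have hsplit : u = delta v + (u - delta v) := by abel
  have hsum : ∑ j, (u - delta v) j = ∑ j, u j - 1 := by
    simp [delta]
  have hpos : 1 ≤ ∑ j, u j :=
    huv.trans (Finset.single_le_sum (f := u) (fun j _ => hu j) (Finset.mem_univ v))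
  obtain ⟨l, hl, hl'⟩ := ih (∑ j, (u - delta v) j).toNat (by omega) (u := u - delta v)
    (s := toppleAt A s v)
    (fun j => by
      simp only [Pi.zero_apply, Pi.sub_apply, delta]
      split_ifs with h
      · subst h; omega
      · simpa using hu j)
    (fun j => by
      have h := hs j
      rw [hsplit, lap_add, Pi.add_apply, ← add_assoc] at h
      exact h) rfl
  exact ⟨v :: l, ⟨not_false, by omega, hl⟩, hl'⟩

lemma stabilizable_iff (hEul : Eulerian A) (s : V → ℤ) :
    Stabilizable A s ↔ ∃ u : V → ℤ, ∀ j, s j + lap A u j ≤ (deg A j : ℤ) - 1 := by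
  constructor
  · rintro ⟨l, _, hl⟩
    obtain ⟨u, hu⟩ := exists_applySeq_eq (A := A) s l
    exact ⟨u, fun j => by simpa [hu] using hl j not_false⟩
  · rintro ⟨u, hu⟩
    refine stabilizable_of_nonneg (u := u + fun _ => ∑ k, |u k|) (fun j => ?_) fun j => ?_
    · have := Finset.single_le_sum (f := fun k => |u k|) (fun k _ => abs_nonneg _)
        (Finset.mem_univ j)
      have := neg_abs_le (u j)
      simp only [Pi.zero_apply, Pi.add_apply]
      linarith
    · rw [lap_add, lap_const hEul, add_zero]
      exact hu j

lemma stabilizable_add_lap_iff (hEul : Eulerian A) (s u : V → ℤ) :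
    Stabilizable A (s + lap A u) ↔ Stabilizable A s := by
  rw [stabilizable_iff hEul, stabilizable_iff hEul]
  constructor
  · rintro ⟨t, ht⟩
    exact ⟨u + t, fun j => by simpa [lap_add, add_assoc] using ht j⟩
  · rintro ⟨t, ht⟩
    refine ⟨t - u, fun j => ?_⟩
    have h : lap A u + lap A (t - u) = lap A t := by rw [← lap_add, add_sub_cancel]
    have := congrFun h j
    simp only [Pi.add_apply] at this ⊢
    linarith [ht j]

lemma Stabilizable.mono (hEul : Eulerian A) {s t : V → ℤ} (h : s ≤ t)
    (ht : Stabilizable A t) : Stabilizable A s := by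
  rw [stabilizable_iff hEul] at ht ⊢
  exact ht.imp fun u hu j => (add_le_add_left (h j) _).trans (hu j)

lemma Stabilizable.totalMass_le (hEul : Eulerian A) {s : V → ℤ} (h : Stabilizable A s) :
    totalMass s ≤ ∑ j, (deg A j : ℤ) := by
  obtain ⟨u, hu⟩ := (stabilizable_iff hEul s).1 h
  calc totalMass s = totalMass (s + lap A u) := by
        rw [totalMass_add, totalMass_lap, add_zero]
    _ ≤ ∑ j, (deg A j : ℤ) := Finset.sum_le_sum fun j _ => (hu j).trans (by omega)

lemma exists_forall_totalMass_le_stabilizable (hEul : Eulerian A) (hConn : Connected A) (z : V) :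
    ∃ a : ℤ, ∀ s : V → ℤ, totalMass s ≤ a → Stabilizable A s := by
  obtain ⟨c, hc, H⟩ := exists_smul_eq_lap_add hEul hConn z
  refine ⟨-(c * Fintype.card V), fun s hs => ?_⟩
  obtain ⟨u, m, hum⟩ := H fun v => s v / c + 1
  have hdiv (v : V) : s v - c * (s v / c + 1) ≤ -1 := by
    have h₁ := Int.emod_lt_of_pos (s v) hc
    have h₂ := Int.mul_ediv_add_emod (s v) c
    linarith
  have hm : m ≤ 0 := by
    have h := congrArg totalMass hum
    rw [totalMass_add, totalMass_lap, totalMass_smul_delta, zero_add] at h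
    rw [← h]
    calc totalMass (c • fun v => s v / c + 1) ≤ totalMass (s + fun _ => c) :=
          Finset.sum_le_sum fun v _ => by
            have h₁ := Int.emod_nonneg (s v) hc.ne'
            have h₂ := Int.mul_ediv_add_emod (s v) c
            simp only [Pi.smul_apply, Pi.add_apply, smul_eq_mul]
            linarith
      _ = totalMass s + c * Fintype.card V := by
          rw [totalMass_add]
          simp [totalMass, mul_comm]
      _ ≤ 0 := by linarith
  rw [← stabilizable_add_lap_iff hEul s (-u)]
  refine ⟨[], trivial, fun j _ => ?_⟩
  have hneg : lap A (-u) = -lap A u := (lapHom A).map_neg u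
  have h := congrFun hum j
  have h' := hdiv j
  have hdelta : m * delta z j ≤ 0 :=
    mul_nonpos_of_nonpos_of_nonneg hm (by rw [delta]; split_ifs <;> simp)
  simp only [applySeq, List.foldl_nil, hneg, Pi.add_apply, Pi.neg_apply, Pi.smul_apply,
    smul_eq_mul] at h ⊢
  linarith [Int.natCast_nonneg (deg A j)]

end Stabilizability

section Chain

variable {V : Type*} [Fintype V] [DecidableEq V] {A : V → V → ℕ}

lemma exists_closedAdd_eq (v : V) (s : V → ℤ) :
    ∃ u, closedAdd A v s = s + delta v + lap A u := by
  rw [closedAdd]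
  split_ifs
  · exact exists_applySeq_eq (A := A) (s + delta v) _
  · exact ⟨0, by ext; simp [lap]⟩

lemma exists_chain_eq (s : V → ℤ) (w : List V) :
    ∃ u, chain A s w = s + (w.map delta).sum + lap A u := by
  induction w generalizing s with
  | nil => exact ⟨0, by ext; simp [chain, lap]⟩
  | cons v w ih =>
    obtain ⟨u, hu⟩ := exists_closedAdd_eq (A := A) v s
    obtain ⟨t, ht⟩ := ih (closedAdd A v s)
    refine ⟨u + t, ?_⟩
    rw [chain, List.foldl_cons, ← chain, ht, hu, lap_add, List.map_cons, List.sum_cons]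
    abel

lemma stabilizable_chain_iff (hEul : Eulerian A) (s : V → ℤ) (w : List V) :
    Stabilizable A (chain A s w) ↔ Stabilizable A (s + (w.map delta).sum) := by
  obtain ⟨u, hu⟩ := exists_chain_eq (A := A) s w
  rw [hu, stabilizable_add_lap_iff hEul]

lemma isThresholdWord_append_singleton_iff (hEul : Eulerian A) (s : V → ℤ) (w : List V) (i : V) :
    IsThresholdWord A s (w ++ [i]) ↔
      Stabilizable A (s + (w.map delta).sum) ∧
        ¬ Stabilizable A (s + (w.map delta).sum + delta i) := by
  rw [IsThresholdWord, stabilizable_chain_iff hEul, and_comm]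
  refine and_congr ⟨fun h => ?_, fun h w' hw' hne => ?_⟩ (by simp [add_assoc])
  · exact (stabilizable_chain_iff hEul s w).1 (h w (List.prefix_append _ _) (by simp))
  · obtain ⟨t, rfl⟩ := (List.prefix_concat_iff.1 hw').resolve_left hne
    rw [stabilizable_chain_iff hEul]
    refine h.mono hEul ?_
    rw [List.map_append, List.sum_append, ← add_assoc]
    refine le_add_of_nonneg_right (List.sum_nonneg fun x hx => ?_)
    obtain ⟨v, _, rfl⟩ := List.mem_map.1 hx
    exact delta_nonneg v

lemma totalMass_sum_map_delta (w : List V) : totalMass (w.map delta).sum = w.length := by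
  induction w with
  | nil => simp [totalMass]
  | cons v w ih =>
    rw [List.map_cons, List.sum_cons, totalMass_add, ih, totalMass_delta]
    push_cast [List.length_cons]
    ring

end Chain

section SinkClasses

variable {V : Type*} [Fintype V] [DecidableEq V] {A : V → V → ℕ}

/-- The subgroup generated by the image of the Laplacian and the sink. -/
def sinkLattice (A : V → V → ℕ) (z : V) : AddSubgroup (V → ℤ) :=
  (lapHom A).toAddMonoidHom.range ⊔ AddSubgroup.zmultiples (delta z)

lemma mem_sinkLattice {z : V} {s : V → ℤ} :
    s ∈ sinkLattice A z ↔ ∃ u, ∃ m : ℤ, s = lap A u + m • delta z := by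
  constructor
  · intro h
    obtain ⟨_, ⟨u, rfl⟩, _, ⟨m, rfl⟩, rfl⟩ := AddSubgroup.mem_sup.1 h
    exact ⟨u, m, rfl⟩
  · rintro ⟨u, m, rfl⟩
    exact AddSubgroup.add_mem_sup ⟨u, rfl⟩ ⟨m, rfl⟩

/-- Sandpiles up to toppling and addition or removal of chips at the sink `z`. -/
abbrev SinkClass (A : V → V → ℕ) (z : V) : Type _ := (V → ℤ) ⧸ sinkLattice A z

lemma finite_sinkClass (hEul : Eulerian A) (hConn : Connected A) (z : V) :
    Finite (SinkClass A z) := by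
  obtain ⟨c, hc, H⟩ := exists_smul_eq_lap_add hEul hConn z
  have : AddGroup.FG (SinkClass A z) := by
    have : AddGroup.FG (V → ℤ) := AddGroup.fg_iff_addMonoid_fg.2 inferInstance
    infer_instance
  refine AddCommGroup.finite_of_fg_isAddTorsion _ fun y => ?_
  induction y using QuotientAddGroup.induction_on with
  | _ q =>
  rw [isOfFinAddOrder_iff_zsmul_eq_zero]
  refine ⟨c, hc.ne', ?_⟩
  rw [← QuotientAddGroup.mk_zsmul, QuotientAddGroup.eq_zero_iff]
  exact mem_sinkLattice.2 (H q)

lemma closure_range_mk_delta [Finite (SinkClass A z)] :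
    AddSubmonoid.closure (Set.range fun v => ((delta v : V → ℤ) : SinkClass A z)) = ⊤ := by
  rw [← AddSubgroup.closure_toAddSubmonoid_of_finite, eq_top_iff]
  rintro y -
  rw [AddSubgroup.mem_toAddSubmonoid]
  induction y using QuotientAddGroup.induction_on with
  | _ s =>
  have hs : s = ∑ v, s v • delta v := by
    ext j
    simp [delta]
  rw [hs, ← QuotientAddGroup.mk'_apply, map_sum]
  refine sum_mem fun v _ => ?_
  rw [map_zsmul]
  exact zsmul_mem (AddSubgroup.subset_closure (Set.mem_range_self v)) _

/-- Stabilizability of the sandpiles with sink class `y` and total mass `n`. -/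
def ClassStabilizable (z : V) (y : SinkClass A z) (n : ℤ) : Prop :=
  ∃ s : V → ℤ, (s : SinkClass A z) = y ∧ totalMass s = n ∧ Stabilizable A s

lemma classStabilizable_mk_iff (hEul : Eulerian A) (z : V) (s : V → ℤ) :
    ClassStabilizable z (s : SinkClass A z) (totalMass s) ↔ Stabilizable A s := by
  refine ⟨?_, fun h => ⟨s, rfl, rfl, h⟩⟩
  rintro ⟨t, hts, hmass, ht⟩
  obtain ⟨u, m, hum⟩ := mem_sinkLattice.1 (QuotientAddGroup.eq.1 hts)
  have hs : s = t + lap A u + m • delta z := by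
    rw [add_assoc, ← hum]
    abel
  have hm : m = 0 := by
    have := congrArg totalMass hs
    rw [totalMass_add, totalMass_add, totalMass_lap, totalMass_smul_delta] at this
    omega
  rw [hs, hm, zero_smul, add_zero, stabilizable_add_lap_iff hEul]
  exact ht

lemma mk_delta_sink (z : V) : ((delta z : V → ℤ) : SinkClass A z) = 0 :=
  (QuotientAddGroup.eq_zero_iff _).2 (mem_sinkLattice.2 ⟨0, 1, by ext; simp [lap]⟩)

lemma exists_mk_eq_totalMass_eq (z : V) (y : SinkClass A z) (n : ℤ) :
    ∃ s : V → ℤ, (s : SinkClass A z) = y ∧ totalMass s = n := by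
  induction y using QuotientAddGroup.induction_on with
  | _ s =>
  refine ⟨s + (n - totalMass s) • delta z, ?_, ?_⟩
  · rw [QuotientAddGroup.mk_add, QuotientAddGroup.mk_zsmul, mk_delta_sink, smul_zero, add_zero]
  · rw [totalMass_add, totalMass_smul_delta, add_sub_cancel]

/-- The boundary layer at mass `n`: its value at `y` is `1` when the class `y` is stabilizable
at mass `n` but not at mass `n + 1`, and `0` otherwise. -/
def boundaryIndicator (A : V → V → ℕ) (z : V) (n : ℤ) (y : SinkClass A z) : ℝ :=
  (if ClassStabilizable z y n then 1 else 0) - if ClassStabilizable z y (n + 1) then 1 else 0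

lemma boundaryIndicator_mk (hEul : Eulerian A) (z : V) (s : V → ℤ) :
    boundaryIndicator A z (totalMass s) (s : SinkClass A z) =
      if Stabilizable A s ∧ ¬ Stabilizable A (s + delta z) then 1 else 0 := by
  have h : ClassStabilizable z (s : SinkClass A z) (totalMass s + 1) ↔
      Stabilizable A (s + delta z) := by
    rw [← classStabilizable_mk_iff hEul z, totalMass_add, totalMass_delta,
      QuotientAddGroup.mk_add, mk_delta_sink, add_zero]
  rw [boundaryIndicator, h, classStabilizable_mk_iff hEul]
  have hmono : Stabilizable A (s + delta z) → Stabilizable A s :=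
    Stabilizable.mono hEul (le_add_of_nonneg_right (delta_nonneg z))
  by_cases h₁ : Stabilizable A (s + delta z)
  · simp [h₁, hmono h₁]
  · simp [h₁]

/-- The epicenter is `z` exactly when the walk of sink classes is at the boundary and the next
chip falls at `z`. -/
lemma thresholdProb_getLast_eq (hEul : Eulerian A) (α : V → ℝ) (s : V → ℤ) (z : V) :
    thresholdProb A α s (fun w => w.getLast? = some z) =
      α z * ∑' w : List V, wordProb α w *
        boundaryIndicator A z (totalMass s + w.length)
          ((s : SinkClass A z) + (w.map fun v => ((delta v : V → ℤ) : SinkClass A z)).sum) := by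
  have hinj : Function.Injective fun w : List V => w ++ [z] := List.append_left_injective [z]
  rw [thresholdProb, ← hinj.tsum_eq, ← tsum_mul_left]
  · refine tsum_congr fun w => ?_
    have hmk : (s : SinkClass A z) + (w.map fun v => ((delta v : V → ℤ) : SinkClass A z)).sum =
        ((s + (w.map delta).sum : V → ℤ) : SinkClass A z) := by
      rw [QuotientAddGroup.mk_add, ← QuotientAddGroup.mk'_apply _ (w.map delta).sum,
        map_list_sum, List.map_map]
      rfl
    rw [hmk, ← totalMass_sum_map_delta, ← totalMass_add, boundaryIndicator_mk hEul,
      isThresholdWord_append_singleton_iff hEul]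
    split_ifs <;> simp_all [wordProb, mul_comm]
  · intro w hw
    have h : w.getLast? = some z := by
      by_contra h
      simp [h] at hw
    obtain ⟨w', rfl⟩ := List.getLast?_eq_some_iff.1 h
    exact ⟨w', rfl⟩

lemma boundaryIndicator_eq_zero_of_lt {z : V} {a : ℤ}
    (ha : ∀ s : V → ℤ, totalMass s ≤ a → Stabilizable A s) {n : ℤ} (hn : n < a) :
    boundaryIndicator A z n = 0 := by
  have key (y : SinkClass A z) (m : ℤ) (hm : m ≤ a) : ClassStabilizable z y m := by
    obtain ⟨s, hs, hmass⟩ := exists_mk_eq_totalMass_eq z y m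
    exact ⟨s, hs, hmass, ha s (hmass.trans_le hm)⟩
  ext y
  simp [boundaryIndicator, key y n hn.le, key y (n + 1) hn]

lemma boundaryIndicator_eq_zero_of_gt {z : V} {b : ℤ}
    (hb : ∀ s : V → ℤ, Stabilizable A s → totalMass s < b) {n : ℤ} (hn : b ≤ n) :
    boundaryIndicator A z n = 0 := by
  have key (y : SinkClass A z) (m : ℤ) (hm : b ≤ m) : ¬ ClassStabilizable z y m := by
    rintro ⟨s, -, hmass, hs⟩
    exact absurd (hb s hs) (by omega)
  ext y
  simp [boundaryIndicator, key y n hn, key y (n + 1) (by omega)]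

/-- Every sink class crosses the boundary exactly once as its mass grows. -/
lemma sum_range_boundaryIndicator {z : V} {a b : ℤ}
    (ha : ∀ s : V → ℤ, totalMass s ≤ a → Stabilizable A s)
    (hb : ∀ s : V → ℤ, Stabilizable A s → totalMass s < b) {L : ℕ} (hL : b ≤ a + L)
    (y : SinkClass A z) :
    ∑ j ∈ Finset.range L, boundaryIndicator A z (a + j) y = 1 := by
  have h (j : ℕ) : boundaryIndicator A z (a + j) y =
      (if ClassStabilizable z y (a + j) then 1 else 0) -
        if ClassStabilizable z y (a + (j + 1 : ℕ)) then 1 else 0 := by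
    rw [boundaryIndicator, Nat.cast_succ, add_assoc]
  simp only [h]
  rw [Finset.sum_range_sub' fun j : ℕ =>
    if ClassStabilizable z y (a + j) then (1 : ℝ) else 0]
  have h₀ : ClassStabilizable z y (a + (0 : ℕ)) := by
    obtain ⟨s, hs, hmass⟩ := exists_mk_eq_totalMass_eq z y a
    exact ⟨s, hs, by simpa using hmass, ha s hmass.le⟩
  have h₁ : ¬ ClassStabilizable z y (a + L) := by
    rintro ⟨s, -, hmass, hs⟩
    exact absurd (hb s hs) (by omega)
  rw [if_pos h₀, if_neg h₁, sub_zero]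

end SinkClasses

end ThresholdState

open ThresholdState in
/-- The epicenter has the input distribution: `P{i_τ = i} → α_i` as `|s₀| → -∞`. -/
theorem statement_2 {V : Type*} [Fintype V] [DecidableEq V]
    (A : V → V → ℕ) (hEul : Eulerian A) (hConn : Connected A)
    (α : V → ℝ) (hαpos : ∀ j, 0 < α j) (hαsum : ∑ j, α j = 1) (i : V) :
    ∀ ε : ℝ, 0 < ε → ∃ K : ℤ, K < 0 ∧ ∀ s0 : V → ℤ, totalMass s0 < K →
      |thresholdProb A α s0 (fun w => w.getLast? = some i) - α i| ≤ ε := by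
  intro ε hε
  have := finite_sinkClass hEul hConn i
  have := Fintype.ofFinite (SinkClass A i)
  obtain ⟨a, ha⟩ := exists_forall_totalMass_le_stabilizable hEul hConn i
  obtain ⟨b, hb⟩ : ∃ b : ℤ, ∀ s : V → ℤ, Stabilizable A s → totalMass s < b :=
    ⟨_, fun s hs => Int.lt_add_one_of_le (hs.totalMass_le hEul)⟩
  set L := (b - a).toNat with hLdef
  have hL : b ≤ a + L := by omega
  set κ : ℝ := (Fintype.card (SinkClass A i) : ℝ) with hκdef
  have hκ : κ ≠ 0 := by
    rw [hκdef]
    exact_mod_cast Fintype.card_ne_zero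
  let g : V → SinkClass A i := fun v => ((delta v : V → ℤ) : SinkClass A i)
  let φ : ℕ → SinkClass A i → ℝ := fun j => boundaryIndicator A i (a + j)
  let avg : ℕ → ℝ := fun j => (∑ y, φ j y) / κ
  have havg : ∑ j ∈ Finset.range L, avg j = 1 := by
    simp only [avg, φ]
    rw [← Finset.sum_div, Finset.sum_comm]
    simp only [sum_range_boundaryIndicator ha hb hL]
    rw [Finset.sum_const, Finset.card_univ, nsmul_eq_mul, mul_one, div_self hκ]
  have hlim : Tendsto
      (fun D => ∑ j ∈ Finset.range L, ‖(stepOp α g ^ (D + j)) (φ j) - fun _ => avg j‖)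
      atTop (nhds 0) := by
    rw [← Finset.sum_const_zero (ι := ℕ) (s := Finset.range L)]
    exact tendsto_finsetSum _ fun j _ => (tendsto_add_atTop_iff_nat j).2
      (tendsto_norm_stepOp_pow_sub_average hαpos hαsum closure_range_mk_delta
        (mk_delta_sink i) (φ j))
  obtain ⟨D₀, hD₀⟩ := eventually_atTop.1 (hlim.eventually (gt_mem_nhds hε))
  refine ⟨min (-1) (a - D₀), by omega, fun s0 hs0 => ?_⟩
  obtain ⟨D, hD⟩ : ∃ D : ℕ, a = totalMass s0 + D := ⟨(a - totalMass s0).toNat, by omega⟩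
  rw [thresholdProb_getLast_eq hEul, tsum_wordProb_mul_eq_sum_stepOp_pow (D := D) (L := L)
    (φ := fun k => boundaryIndicator A i (totalMass s0 + k))]
  · have hφ (j : ℕ) : boundaryIndicator A i (totalMass s0 + (D + j : ℕ)) = φ j := by
      simp only [φ]
      rw [hD, Nat.cast_add, add_assoc]
    simp only [hφ]
    set X := ∑ j ∈ Finset.range L, (stepOp α g ^ (D + j)) (φ j) (s0 : SinkClass A i) with hX
    have hαle : α i ≤ 1 :=
      hαsum ▸ Finset.single_le_sum (fun j _ => (hαpos j).le) (Finset.mem_univ i)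
    have hX1 : |X - 1| ≤ ε := by
      rw [← havg, hX, ← Finset.sum_sub_distrib]
      refine (Finset.abs_sum_le_sum_abs _ _).trans
        ((Finset.sum_le_sum fun j _ => ?_).trans (hD₀ D (by omega)).le)
      exact norm_le_pi_norm ((stepOp α g ^ (D + j)) (φ j) - fun _ => avg j) (s0 : SinkClass A i)
    calc |α i * X - α i| = α i * |X - 1| := by
          rw [← mul_sub_one, abs_mul, abs_of_pos (hαpos i)]
      _ ≤ 1 * ε := mul_le_mul hαle hX1 (abs_nonneg _) zero_le_one
      _ = ε := one_mul ε
  · rintro k (hk | hk)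
    · exact boundaryIndicator_eq_zero_of_lt ha (by omega)
    · exact boundaryIndicator_eq_zero_of_gt hb (by omega)
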